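/- arXiv:1204.6361 — 4 statements merged into one kernel-verified Lean document; each statement's English description precedes it below -/
import Mathlib

section
/- Let k, ℓ be positive integers with k ≥ 5, set s = ν₂(k!) + ℓ − b_k − 3 (assume s ≥ 0), and define f_k(n) = Σ_{i=1}^{⌈k/2⌉} C(k, 2i−1)·(2i−1)^n·((2i−1)^(2^(s+1)) − 1). Then for all n ≥ k, the following are equivalent: (i) f_k(n) ≡ 0 (mod 2^(2s+4)); (ii) S([n]_{2^m}, k) is constant modulo 2^(m − b_k + ℓ) for all integers m ≥ s+1 with 2^m − m ≥ s+3; (iii) S([n]_{2^m}, k) is constant modulo 2^(m − b_k + ℓ) for some integer m ≥ s+1 with 2^m − m ≥ s+3. -/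
/-- Stirling numbers of the second kind, via the standard recurrence. -/
def stirling2 : ℕ → ℕ → ℕ
  | 0, 0 => 1
  | 0, _ + 1 => 0
  | _ + 1, 0 => 0
  | n + 1, k + 1 => (k + 1) * stirling2 n (k + 1) + stirling2 n k

/-- The congruence class `[n]_t = { j : j ≥ max(n,t) and j ≡ n (mod t) }`. -/
def cls (n t : ℕ) : Set ℕ := {j | max n t ≤ j ∧ j ≡ n [MOD t]}

/-- `b_k = ⌈log₂ k⌉ - 2`. -/
def bk (k : ℕ) : ℕ := Nat.clog 2 k - 2

/-- A set of naturals is constant modulo `M`. -/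
def ConstMod (M : ℕ) (A : Set ℕ) : Prop := ∀ a ∈ A, ∀ b ∈ A, a ≡ b [MOD M]

/-- The image set `S([n]_{2^m}, k)`. -/
def Scls (k n m : ℕ) : Set ℕ := (fun j => stirling2 j k) '' cls n (2 ^ m)

/-- The function `j ↦ ν₂(S(j,k))` is constant on the set `A`. -/
def ValConstOn (k : ℕ) (A : Set ℕ) : Prop :=
  ∀ i ∈ A, ∀ j ∈ A, padicValNat 2 (stirling2 i k) = padicValNat 2 (stirling2 j k)

/-- `N_{k,m}`: the set of `n` with `k ≤ n < k + 2^m` on which `ν₂ ∘ S(·,k)`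
is non-constant on `[n]_{2^m}`. -/
def Nkm (k m : ℕ) : Set ℕ :=
  {n | k ≤ n ∧ n < k + 2 ^ m ∧ ¬ ValConstOn k (cls n (2 ^ m))}

theorem sum_neg_one_pow_mul_choose_mul_pow (n k : ℕ) :
    ∑ t ∈ Finset.range (k + 1), (-1 : ℤ) ^ t * k.choose t * (t : ℤ) ^ n =
      (-1) ^ k * (k.factorial * stirling2 n k) := by
  induction n generalizing k with
  | zero =>
    cases k with
    | zero => simp [stirling2]
    | succ k =>
      simpa [stirling2] using Int.alternating_sum_range_choose_of_ne k.succ_ne_zero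
  | succ n ih =>
    cases k with
    | zero => simp [stirling2]
    | succ k =>
      have extend : ∑ t ∈ Finset.range (k + 1 + 1), (-1 : ℤ) ^ t * k.choose t * (t : ℤ) ^ n =
          (-1) ^ k * (k.factorial * stirling2 n k) := by
        rw [Finset.sum_range_succ, ih k]
        simp
      have absorb (t : ℕ) : (-1 : ℤ) ^ t * (k + 1).choose t * (t : ℤ) ^ (n + 1) =
          (k + 1) * ((-1 : ℤ) ^ t * (k + 1).choose t * (t : ℤ) ^ n) -
            (k + 1) * ((-1 : ℤ) ^ t * k.choose t * (t : ℤ) ^ n) := by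
        cases t with
        | zero => simp
        | succ t =>
          have h := Nat.add_one_mul_choose_eq k t
          have h' := Nat.choose_succ_succ k t
          zify at h h'
          push_cast at h h' ⊢
          linear_combination (-1 : ℤ) ^ (t + 1) * ((t : ℤ) + 1) ^ n * (-h - (k + 1) * h')
      rw [Finset.sum_congr rfl fun t _ => absorb t, Finset.sum_sub_distrib, ← Finset.mul_sum,
        ← Finset.mul_sum, ih (k + 1), extend]
      simp only [stirling2, Nat.factorial_succ]
      push_cast
      ring

theorem two_pow_dvd_pow_two_pow_sub_one {t : ℤ} (ht : Odd t) (m : ℕ) :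
    (2 : ℤ) ^ (m + 3) ∣ t ^ 2 ^ (m + 1) - 1 := by
  induction m with
  | zero => simpa using Int.eight_dvd_sq_sub_one_of_odd ht
  | succ m ih =>
    have h2 : (2 : ℤ) ∣ t ^ 2 ^ (m + 1) + 1 := (ht.pow.add_one).two_dvd
    have h := mul_dvd_mul ih h2
    rw [← pow_succ] at h
    refine h.trans (dvd_of_eq ?_)
    rw [pow_succ 2 (m + 1), pow_mul]
    ring

theorem two_pow_dvd_pow_two_pow_add_sub {t : ℤ} (ht : Odd t) (s d : ℕ) :
    (2 : ℤ) ^ (2 * s + d + 4) ∣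
      t ^ 2 ^ (s + 1 + d) - 1 - 2 ^ d * (t ^ 2 ^ (s + 1) - 1) := by
  induction d with
  | zero => simp
  | succ d ih =>
    have h1 : (2 : ℤ) ^ (2 * s + (d + 1) + 4) ∣ (t ^ 2 ^ (s + 1 + d) - 1) ^ 2 := by
      have h := two_pow_dvd_pow_two_pow_sub_one ht (s + d)
      rw [show s + d + 1 = s + 1 + d by omega] at h
      refine dvd_trans ?_ (pow_dvd_pow_of_dvd h 2)
      rw [← pow_mul]
      exact pow_dvd_pow _ (by omega)
    have h2 : (2 : ℤ) ^ (2 * s + (d + 1) + 4) ∣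
        2 * (t ^ 2 ^ (s + 1 + d) - 1 - 2 ^ d * (t ^ 2 ^ (s + 1) - 1)) := by
      rw [show 2 * s + (d + 1) + 4 = 2 * s + d + 4 + 1 by omega, pow_succ']
      exact mul_dvd_mul_left 2 ih
    refine (dvd_add h1 h2).trans (dvd_of_eq ?_)
    rw [← add_assoc, pow_succ 2 (s + 1 + d), pow_mul]
    ring

theorem sq_dvd_pow_sub_one_sub {R : Type*} [CommRing R] (y : R) (q : ℕ) :
    (y - 1) ^ 2 ∣ y ^ q - 1 - q * (y - 1) := by
  induction q with
  | zero => simp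
  | succ q ih =>
    obtain ⟨c, hc⟩ := ih
    refine ⟨y * c + q, ?_⟩
    push_cast
    linear_combination y * hc

theorem two_pow_dvd_pow_mul_sub {t : ℤ} (ht : Odd t) (s d q : ℕ) :
    (2 : ℤ) ^ (2 * s + d + 4) ∣
      t ^ (2 ^ (s + 1 + d) * q) - 1 - q * 2 ^ d * (t ^ 2 ^ (s + 1) - 1) := by
  have h1 : (2 : ℤ) ^ (2 * s + d + 4) ∣
      t ^ (2 ^ (s + 1 + d) * q) - 1 - q * (t ^ 2 ^ (s + 1 + d) - 1) := by
    rw [pow_mul]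
    refine dvd_trans ?_ (sq_dvd_pow_sub_one_sub _ q)
    have h := two_pow_dvd_pow_two_pow_sub_one ht (s + d)
    rw [show s + d + 1 = s + 1 + d by omega] at h
    refine dvd_trans ?_ (pow_dvd_pow_of_dvd h 2)
    rw [← pow_mul]
    exact pow_dvd_pow _ (by omega)
  refine (dvd_add h1 (dvd_mul_of_dvd_right (two_pow_dvd_pow_two_pow_add_sub ht s d) q)).trans
    (dvd_of_eq ?_)
  ring

theorem sum_Icc_two_mul_sub_one {M : Type*} [AddCommMonoid M] (k : ℕ) (h : ℕ → M) :
    ∑ i ∈ Finset.Icc 1 ((k + 1) / 2), h (2 * i - 1) =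
      ∑ t ∈ Finset.range (k + 1) with Odd t, h t := by
  refine Finset.sum_nbij' (fun i => 2 * i - 1) (fun t => (t + 1) / 2) ?_ ?_ ?_ ?_ ?_
  all_goals
    simp only [Finset.mem_Icc, Finset.mem_filter, Finset.mem_range, Nat.odd_iff]
  all_goals intros
  all_goals first | trivial | omega

/-- The alternating sum for `k! * S(j, k)` reduces to its odd terms modulo `2 ^ N` for `N ≤ j`. -/
theorem two_pow_dvd_factorial_mul_stirling2_add (k j N : ℕ) (h : N ≤ j) :
    (2 : ℤ) ^ N ∣ (-1) ^ k * (k.factorial * stirling2 j k) +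
      ∑ t ∈ Finset.range (k + 1) with Odd t, (k.choose t : ℤ) * (t : ℤ) ^ j := by
  rw [← sum_neg_one_pow_mul_choose_mul_pow, Finset.sum_filter, ← Finset.sum_add_distrib]
  refine Finset.dvd_sum fun t _ => ?_
  split_ifs with ht
  · simp [ht.neg_one_pow]
  · have h2 : (2 : ℤ) ∣ t := by
      exact_mod_cast (Nat.not_odd_iff_even.mp ht).two_dvd
    rw [add_zero]
    exact dvd_mul_of_dvd_right ((pow_dvd_pow _ h).trans (pow_dvd_pow_of_dvd h2 j)) _

theorem two_pow_dvd_sum_odd_sub (k n s d q : ℕ) :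
    (2 : ℤ) ^ (2 * s + d + 4) ∣
      ∑ t ∈ Finset.range (k + 1) with Odd t, (k.choose t : ℤ) * (t : ℤ) ^ (n + 2 ^ (s + 1 + d) * q)
        - ∑ t ∈ Finset.range (k + 1) with Odd t, (k.choose t : ℤ) * (t : ℤ) ^ n
        - q * 2 ^ d * ∑ t ∈ Finset.range (k + 1) with Odd t,
            (k.choose t : ℤ) * (t : ℤ) ^ n * ((t : ℤ) ^ 2 ^ (s + 1) - 1) := by
  rw [Finset.mul_sum, ← Finset.sum_sub_distrib, ← Finset.sum_sub_distrib]
  refine Finset.dvd_sum fun t ht => ?_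
  have hodd : Odd (t : ℤ) := by exact_mod_cast (Finset.mem_filter.mp ht).2
  refine (dvd_mul_of_dvd_right (two_pow_dvd_pow_mul_sub hodd s d q)
    ((k.choose t : ℤ) * (t : ℤ) ^ n)).trans (dvd_of_eq ?_)
  rw [pow_add]
  ring

theorem two_mul_le_padicValNat_factorial_two_pow (c : ℕ) :
    2 * c ≤ padicValNat 2 (2 ^ c).factorial + 1 := by
  induction c with
  | zero => simp
  | succ c ih =>
    rw [pow_succ', padicValNat_factorial_mul]
    have : c < 2 ^ c := Nat.lt_two_pow_self
    rcases c with _ | c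
    · simp
    · omega

theorem two_mul_bk_lt_padicValNat_factorial {k : ℕ} (hk : 5 ≤ k) :
    2 * bk k + 1 ≤ padicValNat 2 k.factorial := by
  have hc : 2 < Nat.clog 2 k := by
    rw [Nat.lt_clog_iff_pow_lt (by norm_num)]
    omega
  have hlt : 2 ^ (bk k + 1) < k := by
    apply Nat.pow_lt_of_lt_clog
    unfold bk
    omega
  have h := two_mul_le_padicValNat_factorial_two_pow (bk k + 1)
  have hle : padicValNat 2 (2 ^ (bk k + 1)).factorial ≤ padicValNat 2 k.factorial :=
    (padicValNat_dvd_iff_le k.factorial_ne_zero).mp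
      (pow_padicValNat_dvd.trans (Nat.factorial_dvd_factorial hlt.le))
  omega

theorem two_pow_dvd_mul_iff {a : ℕ} (ha : a ≠ 0) (N : ℕ) (x : ℤ) :
    (2 : ℤ) ^ (padicValNat 2 a + N) ∣ a * x ↔ (2 : ℤ) ^ N ∣ x := by
  obtain ⟨w, hw⟩ := pow_padicValNat_dvd (p := 2) (n := a)
  have hodd : ¬ 2 ∣ w := by
    rintro ⟨v, rfl⟩
    exact pow_succ_padicValNat_not_dvd (p := 2) ha ⟨v, by rw [pow_succ, mul_assoc, ← hw]⟩
  have hcop : IsCoprime ((2 : ℤ) ^ N) (w : ℤ) := by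
    apply IsCoprime.pow_left
    exact_mod_cast Nat.isCoprime_iff_coprime.mpr
      ((Nat.Prime.coprime_iff_not_dvd Nat.prime_two).mpr hodd)
  have hcast : (a : ℤ) = 2 ^ padicValNat 2 a * w := by exact_mod_cast hw
  calc (2 : ℤ) ^ (padicValNat 2 a + N) ∣ a * x
      ↔ (2 : ℤ) ^ padicValNat 2 a * 2 ^ N ∣ 2 ^ padicValNat 2 a * (w * x) := by
        rw [← mul_assoc, ← hcast, pow_add]
    _ ↔ (2 : ℤ) ^ N ∣ w * x := mul_dvd_mul_iff_left (by positivity)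
    _ ↔ (2 : ℤ) ^ N ∣ x := ⟨hcop.dvd_of_dvd_mul_left, fun h => dvd_mul_of_dvd_right h _⟩

theorem constMod_iff_of_exponent {k ℓ s n m : ℕ} (hk : 5 ≤ k) (hℓ : 0 < ℓ)
    (hs : s + bk k + 3 = padicValNat 2 k.factorial + ℓ) (hm : s + 1 ≤ m)
    (hm2 : s + 3 ≤ 2 ^ m - m) :
    (∑ i ∈ Finset.Icc 1 ((k + 1) / 2), Nat.choose k (2 * i - 1) * (2 * i - 1) ^ n *
        ((2 * i - 1) ^ (2 ^ (s + 1)) - 1)) ≡ 0 [MOD 2 ^ (2 * s + 4)] ↔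
      ConstMod (2 ^ (m - bk k + ℓ)) (Scls k n m) := by
  obtain ⟨d, rfl⟩ := Nat.exists_eq_add_of_le hm
  have hb := two_mul_bk_lt_padicValNat_factorial hk
  set F : ℤ := ∑ t ∈ Finset.range (k + 1) with Odd t,
    (k.choose t : ℤ) * (t : ℤ) ^ n * ((t : ℤ) ^ 2 ^ (s + 1) - 1) with hF
  have hleft : (∑ i ∈ Finset.Icc 1 ((k + 1) / 2), Nat.choose k (2 * i - 1) * (2 * i - 1) ^ n *
      ((2 * i - 1) ^ (2 ^ (s + 1)) - 1)) ≡ 0 [MOD 2 ^ (2 * s + 4)] ↔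
      (2 : ℤ) ^ (2 * s + 4) ∣ F := by
    rw [sum_Icc_two_mul_sub_one k fun t => k.choose t * t ^ n * (t ^ 2 ^ (s + 1) - 1),
      Nat.modEq_zero_iff_dvd, ← Int.natCast_dvd_natCast, Nat.cast_sum, hF]
    have hcast : ∀ t ∈ {t ∈ Finset.range (k + 1) | Odd t},
        ((k.choose t * t ^ n * (t ^ 2 ^ (s + 1) - 1) : ℕ) : ℤ) =
          (k.choose t : ℤ) * (t : ℤ) ^ n * ((t : ℤ) ^ 2 ^ (s + 1) - 1) := by
      intro t ht
      have : 1 ≤ t ^ 2 ^ (s + 1) := Nat.one_le_pow _ _ (Finset.mem_filter.mp ht).2.pos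
      push_cast [this]
      rfl
    rw [Finset.sum_congr rfl hcast]
    push_cast
    rfl
  have hexp : padicValNat 2 k.factorial + (s + 1 + d - bk k + ℓ) = 2 * s + d + 4 := by omega
  have key (p q : ℕ) (hp : 2 ^ (s + 1 + d) ≤ n + 2 ^ (s + 1 + d) * p)
      (hq : 2 ^ (s + 1 + d) ≤ n + 2 ^ (s + 1 + d) * q) :
      stirling2 (n + 2 ^ (s + 1 + d) * p) k ≡ stirling2 (n + 2 ^ (s + 1 + d) * q) k
          [MOD 2 ^ (s + 1 + d - bk k + ℓ)] ↔
        (2 : ℤ) ^ (2 * s + d + 4) ∣ ((q : ℤ) - p) * (2 ^ d * F) := by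
    have hA := two_pow_dvd_factorial_mul_stirling2_add k _ (2 * s + d + 4)
      (show 2 * s + d + 4 ≤ n + 2 ^ (s + 1 + d) * p by omega)
    have hB := two_pow_dvd_factorial_mul_stirling2_add k _ (2 * s + d + 4)
      (show 2 * s + d + 4 ≤ n + 2 ^ (s + 1 + d) * q by omega)
    have h := dvd_sub (dvd_sub hB hA)
      (dvd_sub (two_pow_dvd_sum_odd_sub k n s d q) (two_pow_dvd_sum_odd_sub k n s d p))
    rw [Nat.modEq_iff_dvd]
    push_cast
    rw [← two_pow_dvd_mul_iff k.factorial_ne_zero, hexp,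
      ← (isUnit_one.neg.pow k : IsUnit ((-1 : ℤ) ^ k)).dvd_mul_left,
      ← dvd_neg (b := ((q : ℤ) - p) * (2 ^ d * F))]
    refine dvd_iff_dvd_of_dvd_sub ?_
    refine h.trans (dvd_of_eq ?_)
    ring
  rw [hleft]
  constructor
  · rintro h _ ⟨i, ⟨hi, hi'⟩, rfl⟩ _ ⟨j, ⟨hj, hj'⟩, rfl⟩
    obtain ⟨p, hp⟩ := (Nat.modEq_iff_dvd' ((le_max_left _ _).trans hi)).mp hi'.symm
    obtain ⟨q, hq⟩ := (Nat.modEq_iff_dvd' ((le_max_left _ _).trans hj)).mp hj'.symm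
    obtain rfl : i = n + 2 ^ (s + 1 + d) * p := by
      have := (le_max_left _ _).trans hi
      omega
    obtain rfl : j = n + 2 ^ (s + 1 + d) * q := by
      have := (le_max_left _ _).trans hj
      omega
    refine (key p q ((le_max_right _ _).trans hi) ((le_max_right _ _).trans hj)).mpr ?_
    apply dvd_mul_of_dvd_right
    rw [show 2 * s + d + 4 = d + (2 * s + 4) by omega, pow_add]
    exact mul_dvd_mul_left _ h
  · intro h
    have hmem (q : ℕ) : n + 2 ^ (s + 1 + d) * (q + 1) ∈ cls n (2 ^ (s + 1 + d)) := by
      refine ⟨max_le (by omega) ?_, by simp [Nat.ModEq]⟩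
      rw [mul_add]
      omega
    have h12 := (key 1 2 (by omega) (by omega)).mp
      (h _ ⟨_, hmem 0, rfl⟩ _ ⟨_, hmem 1, rfl⟩)
    rw [show ((2 : ℕ) : ℤ) - (1 : ℕ) = 1 by norm_num, one_mul,
      show 2 * s + d + 4 = d + (2 * s + 4) by omega, pow_add] at h12
    exact (mul_dvd_mul_iff_left (by positivity)).mp h12

theorem finite_check_constant (k ℓ s : ℕ) (hk : 5 ≤ k) (hℓ : 0 < ℓ)
    (hs : s + bk k + 3 = padicValNat 2 (Nat.factorial k) + ℓ) :
    ∀ n, k ≤ n →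
      (((∑ i ∈ Finset.Icc 1 ((k + 1) / 2),
          Nat.choose k (2 * i - 1) * (2 * i - 1) ^ n *
            ((2 * i - 1) ^ (2 ^ (s + 1)) - 1)) ≡ 0 [MOD 2 ^ (2 * s + 4)]) ↔
        (∀ m, s + 1 ≤ m → s + 3 ≤ 2 ^ m - m →
          ConstMod (2 ^ (m - bk k + ℓ)) (Scls k n m))) ∧
      ((∀ m, s + 1 ≤ m → s + 3 ≤ 2 ^ m - m →
          ConstMod (2 ^ (m - bk k + ℓ)) (Scls k n m)) ↔
        (∃ m, s + 1 ≤ m ∧ s + 3 ≤ 2 ^ m - m ∧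
          ConstMod (2 ^ (m - bk k + ℓ)) (Scls k n m))) := by
  intro n _
  have hex : s + 3 ≤ 2 ^ (s + 3) - (s + 3) := by
    have : s < 2 ^ s := Nat.lt_two_pow_self
    rw [pow_add]
    omega
  refine ⟨⟨fun h m hm hm2 => (constMod_iff_of_exponent hk hℓ hs hm hm2).mp h, fun h => ?_⟩,
    fun h => ⟨s + 3, by omega, hex, h _ (by omega) hex⟩, ?_⟩
  · exact (constMod_iff_of_exponent hk hℓ hs (by omega) hex).mpr (h (s + 3) (by omega) hex)
  · rintro ⟨m, hm, hm2, h⟩ m' hm' hm2'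
    exact (constMod_iff_of_exponent hk hℓ hs hm' hm2').mp
      ((constMod_iff_of_exponent hk hℓ hs hm hm2).mpr h)
end

section
/- Let k, m, n be non-negative integers with n ≥ k ≥ 5, m ≥ b_k, and 2^m ≥ m − b_k + ν₂(k!). Let r ∈ [n]_{2^m} and set c = ν₂(S(r,k)). If m > c + b_k, then the function j ↦ ν₂(S(j,k)) is constant on [n]_{2^m}. -/
open Polynomial in
/-- The polynomial `(X - 1)(X - 2)⋯(X - k)`. -/
noncomputable def shiftedDescPoly (k : ℕ) : ℤ[X] :=
  ∏ i ∈ Finset.range k, (X - C ((i : ℤ) + 1))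

/-- The shift operator on integer sequences. -/
def seqShift : Module.End ℤ (ℕ → ℤ) where
  toFun s n := s (n + 1)
  map_add' _ _ := rfl
  map_smul' _ _ := rfl

lemma seqShift_pow_apply (M : ℕ) (s : ℕ → ℤ) (n : ℕ) : (seqShift ^ M) s n = s (n + M) := by
  induction M generalizing s n with
  | zero => simp
  | succ M ih =>
    rw [pow_succ, Module.End.mul_apply, ih]
    change s (n + M + 1) = s (n + (M + 1))
    rw [add_assoc]

/-- The sequence `n ↦ S(n, k)` with integer values. -/
def stirlingSeq (k n : ℕ) : ℤ := stirling2 n k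

lemma seqShift_stirlingSeq_zero : seqShift (stirlingSeq 0) = 0 := by
  funext n
  simp [seqShift, stirlingSeq, stirling2]

open Polynomial in
lemma aeval_shiftedDescPoly_stirlingSeq (k : ℕ) :
    aeval seqShift (shiftedDescPoly k) (stirlingSeq k) = stirlingSeq 0 := by
  induction k with
  | zero => simp [shiftedDescPoly]
  | succ k ih =>
    have hstep : aeval seqShift (X - C ((k : ℤ) + 1)) (stirlingSeq (k + 1)) = stirlingSeq k := by
      funext n
      rw [map_sub, aeval_X, aeval_C, LinearMap.sub_apply, Module.algebraMap_end_apply,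
        Pi.sub_apply, Pi.smul_apply]
      change ((stirling2 (n + 1) (k + 1) : ℕ) : ℤ) - ((k : ℤ) + 1) • (stirling2 n (k + 1) : ℤ)
        = (stirling2 n k : ℤ)
      rw [stirling2, smul_eq_mul]
      push_cast
      ring
    rw [shiftedDescPoly, Finset.prod_range_succ, map_mul, Module.End.mul_apply, hstep]
    exact ih

open Polynomial in
lemma exists_X_pow_mul_X_sub_one_pow_eq (k : ℕ) :
    ∃ u : ℤ[X], X ^ (k / 2) * (X - 1) ^ ((k + 1) / 2) = shiftedDescPoly k + 2 * u := by
  induction k with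
  | zero => exact ⟨0, by simp [shiftedDescPoly]⟩
  | succ k ih =>
    obtain ⟨u, hu⟩ := ih
    have hP : shiftedDescPoly (k + 1) = shiftedDescPoly k * (X - C ((k : ℤ) + 1)) := by
      rw [shiftedDescPoly, Finset.prod_range_succ, shiftedDescPoly]
    rw [hP]
    obtain ⟨j, rfl | rfl⟩ := Nat.even_or_odd' k
    · have h1 : (2 * j + 1) / 2 = j := by omega
      have h2 : 2 * j / 2 = j := by omega
      have h3 : (2 * j + 1 + 1) / 2 = j + 1 := by omega
      rw [h1, h2] at hu
      rw [h1, h3, pow_succ, ← mul_assoc, hu]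
      refine ⟨u * (X - 1) + shiftedDescPoly (2 * j) * C (j : ℤ), ?_⟩
      simp only [Nat.cast_mul, Nat.cast_ofNat, map_add, map_mul, map_one, map_ofNat]
      ring
    · have h1 : (2 * j + 1) / 2 = j := by omega
      have h2 : (2 * j + 1 + 1) / 2 = j + 1 := by omega
      have h3 : (2 * j + 1 + 1 + 1) / 2 = j + 1 := by omega
      rw [h1, h2] at hu
      rw [h2, h3, pow_succ, mul_right_comm, hu]
      refine ⟨u * X + shiftedDescPoly (2 * j + 1) * C ((j : ℤ) + 1), ?_⟩
      simp only [Nat.cast_mul, Nat.cast_add, Nat.cast_one, Nat.cast_ofNat, map_add, map_mul,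
        map_one, map_ofNat]
      ring

lemma exists_pow_two_pow_sub_one_eq {R : Type*} [CommRing R] (x : R) (e : ℕ) :
    ∃ w : R, x ^ 2 ^ e - 1 = (x - 1) ^ 2 ^ e + 2 * w := by
  induction e with
  | zero => exact ⟨0, by simp⟩
  | succ e ih =>
    obtain ⟨w, hw⟩ := ih
    refine ⟨(x - 1) ^ 2 ^ e * (2 * w) + 2 * w ^ 2 + (x ^ 2 ^ e - 1), ?_⟩
    rw [pow_succ, pow_mul, pow_mul]
    linear_combination (x ^ 2 ^ e - 1 + (x - 1) ^ 2 ^ e + 2 * w) * hw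

/-- Lifting a congruence `x ^ h (x ^ q - 1) ≡ 0` modulo `(P, 2)` to one
modulo `(P, 2 ^ (N + 1))`. -/
lemma exists_pow_mul_pow_two_pow_sub_one_eq {R : Type*} [CommRing R] {x P : R} {h q : ℕ}
    (hx : ∃ u v, x ^ h * (x ^ q - 1) = P * u + 2 * v) (N : ℕ) :
    ∃ u v, x ^ ((N + 1) * h) * (x ^ (q * 2 ^ N) - 1) = P * u + 2 ^ (N + 1) * v := by
  induction N with
  | zero => simpa using hx
  | succ N ih =>
    obtain ⟨u₁, v₁, h₁⟩ := hx
    obtain ⟨u, v, ih⟩ := ih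
    obtain ⟨d, hd⟩ : x ^ q - 1 ∣ x ^ (q * 2 ^ N) - 1 := by
      simpa [pow_mul] using sub_dvd_pow_sub_pow (x ^ q) 1 (2 ^ N)
    have h₂ : x ^ h * (x ^ (q * 2 ^ N) - 1) = P * (u₁ * d) + 2 * (v₁ * d) := by
      rw [hd]
      linear_combination d * h₁
    refine ⟨u * (x ^ h * (x ^ (q * 2 ^ N) - 1)) + 2 ^ (N + 1) * v * (u₁ * d) + 2 * x ^ h * u,
      v * (v₁ * d) + x ^ h * v, ?_⟩
    have e₁ : x ^ ((N + 1 + 1) * h) = x ^ ((N + 1) * h) * x ^ h := by ring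
    have e₂ : x ^ (q * 2 ^ (N + 1)) = x ^ (q * 2 ^ N) * x ^ (q * 2 ^ N) := by ring
    rw [e₁, e₂]
    linear_combination (x ^ h * (x ^ (q * 2 ^ N) - 1) + 2 * x ^ h) * ih
      + 2 ^ (N + 1) * v * h₂

open Polynomial in
/-- Eventual periodicity of `S(·, k)` modulo powers of two, with an explicit preperiod. -/
lemma stirling2_add_modEq {k e N j : ℕ} (hk : (k + 1) / 2 ≤ 2 ^ e)
    (hj : (N + 1) * (k / 2) + 1 ≤ j) :
    stirling2 j k ≡ stirling2 (j + 2 ^ (e + N)) k [MOD 2 ^ (N + 1)] := by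
  have hx : ∃ u v : ℤ[X], X ^ (k / 2) * (X ^ 2 ^ e - 1) = shiftedDescPoly k * u + 2 * v := by
    obtain ⟨u, hu⟩ := exists_X_pow_mul_X_sub_one_pow_eq k
    obtain ⟨w, hw⟩ := exists_pow_two_pow_sub_one_eq (X : ℤ[X]) e
    refine ⟨(X - 1) ^ (2 ^ e - (k + 1) / 2),
      u * (X - 1) ^ (2 ^ e - (k + 1) / 2) + X ^ (k / 2) * w, ?_⟩
    rw [hw, ← Nat.add_sub_of_le hk, pow_add, Nat.add_sub_cancel_left]
    linear_combination (X - 1) ^ (2 ^ e - (k + 1) / 2) * hu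
  obtain ⟨u, v, huv⟩ := exists_pow_mul_pow_two_pow_sub_one_eq hx N
  obtain ⟨t, rfl⟩ := Nat.exists_eq_add_of_le hj
  have hP : aeval seqShift (shiftedDescPoly k * u * X) (stirlingSeq k) = 0 := by
    rw [show shiftedDescPoly k * u * X = u * (X * shiftedDescPoly k) by ring, map_mul, map_mul,
      Module.End.mul_apply, Module.End.mul_apply, aeval_shiftedDescPoly_stirlingSeq, aeval_X,
      seqShift_stirlingSeq_zero, map_zero]
  have hpoly : (X : ℤ[X]) ^ ((N + 1) * (k / 2) + 1 + 2 ^ (e + N)) - X ^ ((N + 1) * (k / 2) + 1)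
      = shiftedDescPoly k * u * X + (2 ^ (N + 1) : ℤ) • (v * X) := by
    rw [smul_eq_C_mul, map_pow, map_ofNat, pow_add 2 e N, pow_add X, pow_succ X]
    linear_combination X * huv
  have key := congrArg (fun p : ℤ[X] => aeval seqShift p (stirlingSeq k) t) hpoly
  simp only [map_sub, map_add, map_pow, map_smul, aeval_X, LinearMap.sub_apply,
    LinearMap.add_apply, LinearMap.smul_apply, Pi.smul_apply, smul_eq_mul,
    Pi.sub_apply, Pi.add_apply, hP, seqShift_pow_apply, Pi.zero_apply, zero_add] at key
  rw [Nat.modEq_iff_dvd]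
  refine ⟨aeval seqShift (v * X) (stirlingSeq k) t, ?_⟩
  rw [add_right_comm, add_comm _ t, add_comm _ t]
  push_cast
  exact key

lemma stirling2_pos {n k : ℕ} (hk : 1 ≤ k) (hn : k ≤ n) : 0 < stirling2 n k := by
  induction n generalizing k with
  | zero => omega
  | succ n ih =>
    obtain ⟨k, rfl⟩ := Nat.exists_eq_add_of_le' hk
    rw [stirling2]
    rcases Nat.lt_or_ge n (k + 1) with h | h
    · rcases Nat.eq_zero_or_pos k with rfl | hk0
      · obtain rfl : n = 0 := by omega
        simp [stirling2]
      · exact Nat.add_pos_right _ (ih hk0 (by omega))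
    · exact Nat.add_pos_left (Nat.mul_pos k.succ_pos (ih hk h)) _

lemma padicValNat_eq_of_modEq {p a b N : ℕ} [Fact p.Prime] (ha : a ≠ 0) (hb : b ≠ 0)
    (h : a ≡ b [MOD p ^ N]) (hN : padicValNat p a < N) : padicValNat p a = padicValNat p b := by
  apply le_antisymm
  · rw [← padicValNat_dvd_iff_le hb]
    exact (h.dvd_iff (pow_dvd_pow p hN.le)).1 pow_padicValNat_dvd
  · by_contra! hlt
    have hdvd : p ^ (padicValNat p a + 1) ∣ b := (padicValNat_dvd_iff_le hb).2 hlt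
    have := (padicValNat_dvd_iff_le ha).1 ((h.dvd_iff (pow_dvd_pow p hN)).2 hdvd)
    omega

lemma padicValNat_two_factorial_two_pow (a : ℕ) :
    padicValNat 2 (Nat.factorial (2 ^ a)) + 1 = 2 ^ a := by
  induction a with
  | zero => simp
  | succ a ih =>
    rw [pow_succ', padicValNat_factorial_mul]
    omega

theorem alg_const_class_a (k m n r : ℕ) (hkn : k ≤ n) (hk : 5 ≤ k) (hm : bk k ≤ m)
    (h2m : m - bk k + padicValNat 2 (Nat.factorial k) ≤ 2 ^ m)
    (hr : r ∈ cls n (2 ^ m))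
    (hc : padicValNat 2 (stirling2 r k) + bk k < m) :
    ValConstOn k (cls n (2 ^ m)) := by
  have hclog : 3 ≤ Nat.clog 2 k := (Nat.lt_clog_iff_pow_lt one_lt_two).2 (by omega)
  obtain ⟨b, hb⟩ : ∃ b, Nat.clog 2 k = b + 2 := ⟨Nat.clog 2 k - 2, by omega⟩
  have hbk : bk k = b := by simp [bk, hb]
  rw [hbk] at hm h2m hc
  obtain ⟨N, rfl⟩ : ∃ N, m = b + 1 + N := ⟨m - b - 1, by omega⟩
  have hkle : k ≤ 2 ^ (b + 2) := hb ▸ Nat.le_pow_clog one_lt_two k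
  have hpow : 2 ^ (b + 2) = 2 * 2 ^ (b + 1) := by ring
  have hhalf : (k + 1) / 2 ≤ 2 ^ (b + 1) := by omega
  have hQ : 2 ^ (b + 1 + N) = 2 ^ N * 2 ^ (b + 1) := by ring
  have hN : N + 1 ≤ 2 ^ N := Nat.lt_two_pow_self
  have hpre : (N + 1) * (k / 2) + 1 ≤ 2 ^ (b + 1 + N) := by
    rcases hkle.eq_or_lt with heq | hlt
    · have hfac : padicValNat 2 (Nat.factorial k) + 1 = k := by
        rw [heq, padicValNat_two_factorial_two_pow]
      have hk2 : k / 2 = 2 ^ (b + 1) := by omega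
      have hN2 : N + 2 ≤ 2 ^ N := by
        by_contra! hlt
        have hle : 2 ^ N * 2 ^ (b + 1) ≤ (N + 1) * 2 ^ (b + 1) :=
          Nat.mul_le_mul_right _ (by omega)
        have hN1 : N ≤ 1 := by
          by_contra! hN1
          obtain ⟨M, rfl⟩ := Nat.exists_eq_add_of_le' hN1
          have hM : M + 1 ≤ 2 ^ M := Nat.lt_two_pow_self
          rw [pow_add] at hlt
          omega
        interval_cases N <;> omega
      have := Nat.mul_le_mul_right (2 ^ (b + 1)) hN2
      have := Nat.one_le_two_pow (n := b + 1)
      rw [hk2, hQ]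
      linarith
    · have hk2 : k / 2 + 1 ≤ 2 ^ (b + 1) := by omega
      calc (N + 1) * (k / 2) + 1 ≤ (N + 1) * (k / 2 + 1) := by linarith [Nat.zero_le N]
        _ ≤ 2 ^ N * 2 ^ (b + 1) := Nat.mul_le_mul hN hk2
        _ = 2 ^ (b + 1 + N) := hQ.symm
  have hperiod : ∀ d j, 2 ^ (b + 1 + N) ≤ j →
      stirling2 j k ≡ stirling2 (j + 2 ^ (b + 1 + N) * d) k [MOD 2 ^ (N + 1)] := by
    intro d j hj
    induction d with
    | zero => rfl
    | succ d ih =>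
      have h := stirling2_add_modEq hhalf (hpre.trans (hj.trans (Nat.le_add_right j (2 ^ (b + 1 + N) * d))))
      rw [Nat.mul_succ, ← add_assoc]
      exact ih.trans h
  have hmod : ∀ i ∈ cls n (2 ^ (b + 1 + N)),
      stirling2 r k ≡ stirling2 i k [MOD 2 ^ (N + 1)] := by
    intro i hi
    have hmodir : i ≡ r [MOD 2 ^ (b + 1 + N)] := hi.2.trans hr.2.symm
    rcases le_total i r with hle | hle
    · obtain ⟨d, hd⟩ := (Nat.modEq_iff_dvd' hle).1 hmodir
      have h := hperiod d i ((le_max_right _ _).trans hi.1)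
      rw [← hd, Nat.add_sub_of_le hle] at h
      exact h.symm
    · obtain ⟨d, hd⟩ := (Nat.modEq_iff_dvd' hle).1 hmodir.symm
      have h := hperiod d r ((le_max_right _ _).trans hr.1)
      rwa [← hd, Nat.add_sub_of_le hle] at h
  have hne : ∀ i ∈ cls n (2 ^ (b + 1 + N)), stirling2 i k ≠ 0 := fun i hi =>
    (stirling2_pos (by omega) (hkn.trans ((le_max_left _ _).trans hi.1))).ne'
  have hval : ∀ i ∈ cls n (2 ^ (b + 1 + N)),
      padicValNat 2 (stirling2 r k) = padicValNat 2 (stirling2 i k) := fun i hi =>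
    padicValNat_eq_of_modEq (hne r hr) (hne i hi) (hmod i hi) (by omega)
  exact fun i hi j hj => (hval i hi).symm.trans (hval j hj)
end

section
/- For every integer m ≥ 1, there are exactly two integers n with 5 ≤ n < 5 + 2^m such that the function j ↦ ν₂(S(j,5)) is non-constant on [n]_{2^m}; moreover, for every m ≥ 1, whenever j ↦ ν₂(S(j,5)) is non-constant on a class [n]_{2^m}, it is non-constant on exactly one of the two children [n]_{2^(m+1)} and [n + 2^m]_{2^(m+1)}. In particular, N_{5,3} = {7, 12}. -/
theorem stirling2_closed_forms (n : ℕ) :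
    (stirling2 (n + 1) 1 : ℤ) = 1 ∧
    (2 * stirling2 (n + 1) 2 : ℤ) = 2 ^ (n + 1) - 2 ∧
    (6 * stirling2 (n + 1) 3 : ℤ) = 3 ^ (n + 1) - 3 * 2 ^ (n + 1) + 3 ∧
    (24 * stirling2 (n + 1) 4 : ℤ) = 4 ^ (n + 1) - 4 * 3 ^ (n + 1) + 6 * 2 ^ (n + 1) - 4 ∧
    (24 * stirling2 (n + 1) 5 : ℤ) = 5 ^ n - 4 ^ (n + 1) + 2 * 3 ^ (n + 1) - 2 ^ (n + 2) + 1 := by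
  induction n with
  | zero => simp [stirling2]
  | succ n ih =>
    obtain ⟨h1, h2, h3, h4, h5⟩ := ih
    have r1 : stirling2 (n + 1 + 1) 1 = 1 * stirling2 (n + 1) 1 + 0 := rfl
    have r2 : stirling2 (n + 1 + 1) 2 = 2 * stirling2 (n + 1) 2 + stirling2 (n + 1) 1 := rfl
    have r3 : stirling2 (n + 1 + 1) 3 = 3 * stirling2 (n + 1) 3 + stirling2 (n + 1) 2 := rfl
    have r4 : stirling2 (n + 1 + 1) 4 = 4 * stirling2 (n + 1) 4 + stirling2 (n + 1) 3 := rfl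
    have r5 : stirling2 (n + 1 + 1) 5 = 5 * stirling2 (n + 1) 5 + stirling2 (n + 1) 4 := rfl
    rw [r1, r2, r3, r4, r5]
    push_cast
    simp only [pow_succ] at *
    refine ⟨?_, ?_, ?_, ?_, ?_⟩ <;> linarith

theorem stirling2_five_pos {n : ℕ} (hn : 5 ≤ n) : 0 < stirling2 n 5 := by
  induction n, hn using Nat.le_induction with
  | base => simp [stirling2]
  | succ n _ ih =>
    have h : stirling2 (n + 1) 5 = 5 * stirling2 n 5 + stirling2 n 4 := rfl
    omega

theorem five_pow_two_pow (p : ℕ) : ∃ u : ℤ, Odd u ∧ (5 : ℤ) ^ 2 ^ (p + 1) = 1 + 8 * 2 ^ p * u := by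
  induction p with
  | zero => exact ⟨3, by decide, by norm_num⟩
  | succ p ih =>
    obtain ⟨u, hu, h⟩ := ih
    refine ⟨u + 2 * (2 * 2 ^ p * u ^ 2), hu.add_even (even_two_mul _), ?_⟩
    rw [pow_succ 2 (p + 1), pow_mul, h]
    ring

theorem three_pow_two_pow (p : ℕ) : ∃ v : ℤ, (3 : ℤ) ^ 2 ^ (p + 1) = 1 + 8 * 2 ^ p * v := by
  induction p with
  | zero => exact ⟨1, by norm_num⟩
  | succ p ih =>
    obtain ⟨v, h⟩ := ih
    refine ⟨v + 2 * (2 * 2 ^ p * v ^ 2), ?_⟩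
    rw [pow_succ 2 (p + 1), pow_mul, h]
    ring

/-- Shifting the argument by `2 ^ (p + 1)` changes `S(n, 5)` by an odd multiple of `2 ^ p`. -/
theorem stirling2_five_add_two_pow {n p : ℕ} (hn : p + 3 ≤ n) :
    ∃ c : ℤ, Odd c ∧ (stirling2 (n + 2 ^ (p + 1)) 5 : ℤ) = stirling2 n 5 + 2 ^ p * c := by
  obtain ⟨s, rfl⟩ := Nat.exists_eq_add_of_le hn
  obtain ⟨u, hu, h5⟩ := five_pow_two_pow p
  obtain ⟨v, h3⟩ := three_pow_two_pow p
  obtain ⟨-, -, -, -, ha⟩ := stirling2_closed_forms (p + 2 + s)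
  obtain ⟨-, -, -, -, hb⟩ := stirling2_closed_forms (p + 2 + s + 2 ^ (p + 1))
  rw [show p + 2 + s + 1 = p + 3 + s by ring] at ha
  rw [show p + 2 + s + 2 ^ (p + 1) + 1 = p + 3 + s + 2 ^ (p + 1) by ring] at hb
  set x := (stirling2 (p + 3 + s) 5 : ℤ)
  set y := (stirling2 (p + 3 + s + 2 ^ (p + 1)) 5 : ℤ)
  set T := 2 ^ (p + 1)
  set w : ℤ := 5 ^ (p + 2 + s) * u + 2 * (3 ^ (p + 3 + s) * v
    - 2 ^ (p + 2 + 2 * s) * (4 ^ T - 1) - 2 ^ s * (2 ^ T - 1)) with hw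
  have hwo : Odd w :=
    ((Odd.pow (by decide)).mul hu).add_even (even_two_mul _)
  have hd : 3 * (y - x) = 2 ^ p * w := by
    have e4 : (4 : ℤ) ^ (p + 3 + s) = 8 * 2 ^ p * (2 * 2 ^ (p + 2 + 2 * s)) := by
      rw [show (4 : ℤ) = 2 ^ 2 by norm_num, ← pow_mul]
      ring
    have e2 : (2 : ℤ) ^ (p + 2 + s + 2) = 8 * 2 ^ p * (2 * 2 ^ s) := by ring
    have k5 : (5 : ℤ) ^ (p + 2 + s + T) = 5 ^ (p + 2 + s) * (1 + 8 * 2 ^ p * u) := by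
      rw [pow_add, h5]
    have k3 : (3 : ℤ) ^ (p + 3 + s + T) = 3 ^ (p + 3 + s) * (1 + 8 * 2 ^ p * v) := by
      rw [pow_add, h3]
    have k4 : (4 : ℤ) ^ (p + 3 + s + T) = 4 ^ (p + 3 + s) * 4 ^ T := pow_add _ _ _
    have k2 : (2 : ℤ) ^ (p + 2 + s + T + 2) = 2 ^ (p + 2 + s + 2) * 2 ^ T := by
      rw [← pow_add]; congr 1; ring
    rw [k5, k3, k4, k2, e4, e2] at hb
    rw [e4, e2] at ha
    have : 24 * (y - x) = 8 * (2 ^ p * w) := by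
      rw [mul_sub, ha, hb, hw]
      ring
    linarith
  have hdvd : (2 : ℤ) ^ p ∣ y - x :=
    (IsCoprime.pow_left (by norm_num : IsCoprime (2 : ℤ) 3)).dvd_of_dvd_mul_left ⟨w, hd⟩
  obtain ⟨c, hc⟩ := hdvd
  refine ⟨c, ?_, eq_add_of_sub_eq' hc⟩
  have h3c : 3 * c = w := by
    have : (2 : ℤ) ^ p * (3 * c) = 2 ^ p * w := by rw [← hd, hc]; ring
    exact mul_left_cancel₀ (by positivity) this
  rw [← h3c] at hwo
  exact (Int.odd_mul.mp hwo).2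

theorem two_pow_dvd_stirling2_five_add_mul {n p : ℕ} (hn : p + 3 ≤ n) (t : ℕ) :
    (2 : ℤ) ^ p ∣ stirling2 (n + 2 ^ (p + 1) * t) 5 - stirling2 n 5 := by
  induction t with
  | zero => simp
  | succ t ih =>
    obtain ⟨c, -, hc⟩ := stirling2_five_add_two_pow (n := n + 2 ^ (p + 1) * t) (p := p)
      (le_add_right hn)
    rw [mul_add_one, ← add_assoc, hc, add_sub_right_comm]
    exact dvd_add ih (dvd_mul_right _ _)

/-- If `2 ^ p ∣ x`, then `2 ^ (p + 1)` divides exactly one of `x` and `x + 2 ^ p * c`, `c` odd. -/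
theorem two_pow_succ_dvd_add_odd_mul_iff {p : ℕ} {x c : ℤ} (hx : 2 ^ p ∣ x) (hc : Odd c) :
    2 ^ (p + 1) ∣ x + 2 ^ p * c ↔ ¬ 2 ^ (p + 1) ∣ x := by
  obtain ⟨a, rfl⟩ := hx
  have h0 : (2 : ℤ) ^ p ≠ 0 := by positivity
  rw [← mul_add, pow_succ, mul_dvd_mul_iff_left h0, mul_dvd_mul_iff_left h0]
  obtain ⟨b, rfl⟩ := hc
  omega

theorem le_of_five_le_of_two_pow_le {j p : ℕ} (h5 : 5 ≤ j) (hj : 2 ^ (p + 1) ≤ j) :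
    p + 3 ≤ j := by
  have : p < 2 ^ p := Nat.lt_two_pow_self
  rw [pow_succ] at hj
  by_cases hp : p ≤ 2
  · omega
  · have : p - 1 < 2 ^ (p - 1) := Nat.lt_two_pow_self
    have : 2 ^ p = 2 ^ (p - 1) * 2 := by rw [← pow_succ]; congr 1; omega
    omega

theorem padicValNat_two_eq_of_dvd_sub {p x y : ℕ} (hx : 0 < x) (hy : 0 < y)
    (h : (2 : ℤ) ^ p ∣ y - x) (hnx : ¬ (2 : ℤ) ^ p ∣ x) :
    padicValNat 2 x = padicValNat 2 y := by
  have hny : ¬ (2 : ℤ) ^ p ∣ y := fun hy' => hnx ((dvd_iff_dvd_of_dvd_sub h).mp hy')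
  have key : ∀ k, 2 ^ k ∣ x ↔ 2 ^ k ∣ y := by
    intro k
    have hX : (2 ^ k ∣ x) ↔ (2 : ℤ) ^ k ∣ x := by exact_mod_cast Int.natCast_dvd_natCast.symm
    have hY : (2 ^ k ∣ y) ↔ (2 : ℤ) ^ k ∣ y := by exact_mod_cast Int.natCast_dvd_natCast.symm
    rw [hX, hY]
    rcases le_total k p with hk | hk
    · exact (dvd_iff_dvd_of_dvd_sub ((pow_dvd_pow 2 hk).trans h)).symm
    · exact iff_of_false (fun h' => hnx ((pow_dvd_pow 2 hk).trans h'))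
        (fun h' => hny ((pow_dvd_pow 2 hk).trans h'))
  exact le_antisymm
    ((padicValNat_dvd_iff_le hy.ne').mp ((key _).mp pow_padicValNat_dvd))
    ((padicValNat_dvd_iff_le hx.ne').mp ((key _).mpr pow_padicValNat_dvd))

theorem two_pow_dvd_stirling2_five_sub {n j p : ℕ} (hn : 5 ≤ n) (hj : j ∈ cls n (2 ^ (p + 1))) :
    (2 : ℤ) ^ p ∣ stirling2 j 5 - stirling2 (n + 2 ^ (p + 1)) 5 := by
  obtain ⟨hle, hmod⟩ := hj
  have hjn := (le_max_left _ _).trans hle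
  have hj2 := (le_max_right _ _).trans hle
  rcases le_total j (n + 2 ^ (p + 1)) with h | h
  · have hm : j ≡ n + 2 ^ (p + 1) [MOD 2 ^ (p + 1)] := by simpa [Nat.ModEq] using hmod
    obtain ⟨t, ht⟩ := (Nat.modEq_iff_dvd' h).mp hm
    have := two_pow_dvd_stirling2_five_add_mul (n := j) (p := p)
      (le_of_five_le_of_two_pow_le (hn.trans hjn) hj2) t
    rw [← ht, Nat.add_sub_cancel' h] at this
    exact (dvd_sub_comm).mp this
  · have hm : n + 2 ^ (p + 1) ≡ j [MOD 2 ^ (p + 1)] := by simpa [Nat.ModEq] using hmod.symm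
    obtain ⟨t, ht⟩ := (Nat.modEq_iff_dvd' h).mp hm
    have := two_pow_dvd_stirling2_five_add_mul (n := n + 2 ^ (p + 1)) (p := p)
      (le_of_five_le_of_two_pow_le (le_add_right hn) (Nat.le_add_left _ _)) t
    rwa [← ht, Nat.add_sub_cancel' h] at this

theorem not_valConstOn_five_iff {n : ℕ} (p : ℕ) (hn : 5 ≤ n) :
    ¬ ValConstOn 5 (cls n (2 ^ (p + 1))) ↔ (2 : ℤ) ^ p ∣ stirling2 (n + 2 ^ (p + 1)) 5 := by
  constructor
  · contrapose!
    intro h i hi j hj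
    have aux : ∀ i ∈ cls n (2 ^ (p + 1)), padicValNat 2 (stirling2 (n + 2 ^ (p + 1)) 5) =
        padicValNat 2 (stirling2 i 5) := fun i hi =>
      padicValNat_two_eq_of_dvd_sub (stirling2_five_pos (le_add_right hn))
        (stirling2_five_pos (hn.trans ((le_max_left _ _).trans hi.1)))
        (two_pow_dvd_stirling2_five_sub hn hi) h
    rw [← aux i hi, ← aux j hj]
  · intro h hconst
    obtain ⟨c, hc, hd⟩ := stirling2_five_add_two_pow (n := n + 2 ^ (p + 1)) (p := p)
      (le_of_five_le_of_two_pow_le (le_add_right hn) (Nat.le_add_left _ _))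
    have heq := hconst (n + 2 ^ (p + 1)) ⟨by simp, by simp [Nat.ModEq]⟩
      (n + 2 ^ (p + 1) + 2 ^ (p + 1)) ⟨max_le (by simp [add_assoc]) (Nat.le_add_left _ _), by simp [Nat.ModEq]⟩
    have hiff := two_pow_succ_dvd_add_odd_mul_iff h hc
    rw [← hd] at hiff
    have hcast : ∀ i, 5 ≤ i → ((2 : ℤ) ^ (p + 1) ∣ stirling2 i 5 ↔
        p + 1 ≤ padicValNat 2 (stirling2 i 5)) := by
      intro i hi
      rw [← padicValNat_dvd_iff_le (stirling2_five_pos hi).ne']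
      exact_mod_cast Int.natCast_dvd_natCast
    rw [hcast _ (le_add_right (le_add_right hn)), hcast _ (le_add_right hn), heq] at hiff
    tauto

theorem not_valConstOn_five_children_xor {m n : ℕ} (hm : 1 ≤ m) (hn : 5 ≤ n)
    (h : ¬ ValConstOn 5 (cls n (2 ^ m))) :
    Xor (¬ ValConstOn 5 (cls n (2 ^ (m + 1))))
      (¬ ValConstOn 5 (cls (n + 2 ^ m) (2 ^ (m + 1)))) := by
  obtain ⟨p, rfl⟩ := Nat.exists_eq_add_of_le' hm
  have hdvd := two_pow_dvd_stirling2_five_sub (n := n) (j := n + 2 ^ (p + 1 + 1)) (p := p) hn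
    ⟨by simp [pow_succ]; omega, by simp [Nat.ModEq, pow_succ _ (p + 1)]⟩
  rw [not_valConstOn_five_iff p hn] at h
  rw [not_valConstOn_five_iff (p + 1) hn, not_valConstOn_five_iff (p + 1) (le_add_right hn)]
  obtain ⟨c, hc, hd⟩ := stirling2_five_add_two_pow (n := n + 2 ^ (p + 1 + 1)) (p := p)
    (le_of_five_le_of_two_pow_le (le_add_right hn)
      (le_add_left (Nat.pow_le_pow_right two_pos (p + 1).le_succ)))
  have hiff := two_pow_succ_dvd_add_odd_mul_iff ((dvd_iff_dvd_of_dvd_sub hdvd).mpr h) hc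
  rw [← hd, add_right_comm] at hiff
  simp only [Xor]
  tauto

theorem not_valConstOn_five_of_child {m n : ℕ} (hn : 5 ≤ n)
    (h : ¬ ValConstOn 5 (cls n (2 ^ (m + 1))) ∨
      ¬ ValConstOn 5 (cls (n + 2 ^ m) (2 ^ (m + 1)))) :
    ¬ ValConstOn 5 (cls n (2 ^ m)) := by
  contrapose! h
  have hpow : 2 ^ m ∣ 2 ^ (m + 1) := pow_dvd_pow 2 m.le_succ
  have hle : 2 ^ m ≤ 2 ^ (m + 1) := Nat.pow_le_pow_right two_pos m.le_succ
  constructor <;> intro i hi j hj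
  · have aux : ∀ i ∈ cls n (2 ^ (m + 1)), i ∈ cls n (2 ^ m) := fun i hi =>
      ⟨(max_le_max_left n hle).trans hi.1, hi.2.of_dvd hpow⟩
    exact h i (aux i hi) j (aux j hj)
  · have aux : ∀ i ∈ cls (n + 2 ^ m) (2 ^ (m + 1)), i ∈ cls n (2 ^ m) := fun i hi =>
      ⟨by have := hi.1; simp at this ⊢; omega,
        (hi.2.of_dvd hpow).trans (by simp [Nat.ModEq])⟩
    exact h i (aux i hi) j (aux j hj)

theorem Nkm_five_three : Nkm 5 3 = {7, 12} := by
  ext n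
  simp only [Nkm, Set.mem_ofPred_eq, Set.mem_insert_iff, Set.mem_singleton_iff]
  constructor
  · rintro ⟨h5, hlt, h⟩
    rw [not_valConstOn_five_iff 2 h5] at h
    obtain ⟨-, -, -, -, hc⟩ := stirling2_closed_forms (n + 7)
    norm_num at hlt h
    interval_cases n <;> norm_num at h hc ⊢ <;> omega
  · rintro (rfl | rfl)
    · refine ⟨by norm_num, by norm_num, (not_valConstOn_five_iff 2 (by norm_num)).mpr ?_⟩
      obtain ⟨-, -, -, -, hc⟩ := stirling2_closed_forms 14
      norm_num at hc ⊢
      omega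
    · refine ⟨by norm_num, by norm_num, (not_valConstOn_five_iff 2 (by norm_num)).mpr ?_⟩
      obtain ⟨-, -, -, -, hc⟩ := stirling2_closed_forms 19
      norm_num at hc ⊢
      omega

theorem ncard_Nkm_five_succ {m : ℕ} (hm : 1 ≤ m) :
    (Nkm 5 (m + 1)).ncard = (Nkm 5 m).ncard := by
  have hpow : 2 ^ (m + 1) = 2 ^ m + 2 ^ m := by ring
  have hmem : ∀ n ∈ Nkm 5 (m + 1), (if n < 5 + 2 ^ m then n else n - 2 ^ m) ∈ Nkm 5 m := by
    rintro n ⟨h5, hlt, h⟩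
    split_ifs with hn
    · exact ⟨h5, hn, not_valConstOn_five_of_child h5 (.inl h)⟩
    · refine ⟨by omega, by omega, not_valConstOn_five_of_child (by omega) (.inr ?_)⟩
      rwa [Nat.sub_add_cancel (by omega)]
  refine Set.ncard_congr (fun n _ => if n < 5 + 2 ^ m then n else n - 2 ^ m) hmem ?_ ?_
  · have clash : ∀ a, a ∈ Nkm 5 (m + 1) → a + 2 ^ m ∈ Nkm 5 (m + 1) → False := by
      rintro a ⟨h5, -, ha⟩ ⟨-, -, hb⟩
      have := not_valConstOn_five_children_xor hm h5
        (not_valConstOn_five_of_child h5 (.inl ha))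
      simp only [Xor] at this
      tauto
    intro a b ha hb hab
    split_ifs at hab with h1 h2 h2
    · exact hab
    · exact (clash a ha (by rwa [show a + 2 ^ m = b by omega])).elim
    · exact (clash b hb (by rwa [show b + 2 ^ m = a by omega])).elim
    · omega
  · rintro b ⟨h5, hlt, h⟩
    rcases not_valConstOn_five_children_xor hm h5 h with ⟨h', -⟩ | ⟨h', -⟩
    · exact ⟨b, ⟨h5, by omega, h'⟩, by simp [hlt]⟩
    · exact ⟨b + 2 ^ m, ⟨by omega, by omega, h'⟩, by rw [if_neg (by omega)]; omega⟩

theorem Nkm_five_one : Nkm 5 1 = {5, 6} := by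
  ext n
  simp only [Nkm, Set.mem_ofPred_eq, Set.mem_insert_iff, Set.mem_singleton_iff]
  refine ⟨by omega, fun h => ⟨by omega, by omega, ?_⟩⟩
  exact (not_valConstOn_five_iff 0 (by omega)).mpr (by simp)

theorem AMM_k5 :
    (∀ m, 1 ≤ m → (Nkm 5 m).ncard = 2) ∧
    (∀ m, 1 ≤ m → ∀ n, 5 ≤ n → ¬ ValConstOn 5 (cls n (2 ^ m)) →
      Xor' (¬ ValConstOn 5 (cls n (2 ^ (m + 1))))
        (¬ ValConstOn 5 (cls (n + 2 ^ m) (2 ^ (m + 1))))) ∧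
    Nkm 5 3 = {7, 12} := by
  refine ⟨fun m hm => ?_, fun m hm n hn h => not_valConstOn_five_children_xor hm hn h,
    Nkm_five_three⟩
  induction m, hm using Nat.le_induction with
  | base => rw [Nkm_five_one]; exact Set.ncard_pair (by norm_num)
  | succ m hm ih => rw [ncard_Nkm_five_succ hm, ih]
end

section
/- For every integer m ≥ 3 and every integer n ≥ 7, the set S([n]_{2^m}, 7) = { S(j,7) : j ∈ [n]_{2^m} } is not constant modulo 2^(m+1) if and only if n is odd. -/
/-- The explicit formulas for `k! * S(n, k)` with `1 ≤ k ≤ 7` and `n ≥ 1`. -/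
theorem factorial_mul_stirling2 (n : ℕ) :
    (stirling2 (n + 1) 0 : ℤ) = 0 ∧
    (stirling2 (n + 1) 1 : ℤ) = 1 ∧
    2 * (stirling2 (n + 1) 2 : ℤ) = 2 ^ (n + 1) - 2 ∧
    6 * (stirling2 (n + 1) 3 : ℤ) = 3 ^ (n + 1) - 3 * 2 ^ (n + 1) + 3 ∧
    24 * (stirling2 (n + 1) 4 : ℤ) = 4 ^ (n + 1) - 4 * 3 ^ (n + 1) + 6 * 2 ^ (n + 1) - 4 ∧
    120 * (stirling2 (n + 1) 5 : ℤ) =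
      5 ^ (n + 1) - 5 * 4 ^ (n + 1) + 10 * 3 ^ (n + 1) - 10 * 2 ^ (n + 1) + 5 ∧
    720 * (stirling2 (n + 1) 6 : ℤ) =
      6 ^ (n + 1) - 6 * 5 ^ (n + 1) + 15 * 4 ^ (n + 1) - 20 * 3 ^ (n + 1)
        + 15 * 2 ^ (n + 1) - 6 ∧
    5040 * (stirling2 (n + 1) 7 : ℤ) =
      7 ^ (n + 1) - 7 * 6 ^ (n + 1) + 21 * 5 ^ (n + 1) - 35 * 4 ^ (n + 1)
        + 35 * 3 ^ (n + 1) - 21 * 2 ^ (n + 1) + 7 := by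
  induction n with
  | zero => simp [stirling2]
  | succ n ih =>
    have step (k : ℕ) : (stirling2 (n + 1 + 1) (k + 1) : ℤ)
        = (k + 1) * stirling2 (n + 1) (k + 1) + stirling2 (n + 1) k := by
      rw [stirling2]; push_cast; ring
    have s1 := step 0
    have s2 := step 1
    have s3 := step 2
    have s4 := step 3
    have s5 := step 4
    have s6 := step 5
    have s7 := step 6
    norm_num at s1 s2 s3 s4 s5 s6 s7
    obtain ⟨h0, h1, h2, h3, h4, h5, h6, h7⟩ := ih
    simp only [s1, s2, s3, s4, s5, s6, s7, pow_succ _ (n + 1)]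
    refine ⟨by simp [stirling2], ?_, ?_, ?_, ?_, ?_, ?_, ?_⟩ <;> linarith

theorem pow_two_pow_modEq {x c : ℤ} (h : x ^ 2 ^ 3 ≡ 1 + 2 ^ 5 * c [ZMOD 2 ^ 8])
    {m : ℕ} (hm : 3 ≤ m) :
    x ^ 2 ^ m ≡ 1 + 2 ^ (m + 2) * c [ZMOD 2 ^ (m + 5)] := by
  induction m, hm using Nat.le_induction with
  | base => simpa using h
  | succ m hm ih =>
    obtain ⟨d, hd⟩ := ih.symm.dvd
    obtain ⟨r, rfl⟩ := Nat.exists_eq_add_of_le hm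
    refine (Int.modEq_iff_dvd.2 ?_).symm
    have hx : x ^ 2 ^ (3 + r) = 1 + 2 ^ (3 + r + 2) * (c + 8 * d) := by
      linear_combination hd
    refine ⟨d + 2 ^ (r + 1) * (c + 8 * d) ^ 2, ?_⟩
    rw [pow_succ 2 (3 + r), pow_mul, hx]
    ring

theorem stirling2_seven_add_two_pow {m a : ℕ} (hm : 3 ≤ m) (ha : 2 ^ m ≤ a) :
    5040 * ((stirling2 (a + 2 ^ m) 7 : ℤ) - stirling2 a 7) ≡
      2 ^ (m + 2) * (6 * 7 ^ a + 147 * 5 ^ a + 175 * 3 ^ a) [ZMOD 2 ^ (m + 5)] := by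
  have formula {j : ℕ} (hj : 2 ^ m ≤ j) : 5040 * (stirling2 j 7 : ℤ) ≡
      7 ^ j + 21 * 5 ^ j + 35 * 3 ^ j + 7 [ZMOD 2 ^ (m + 5)] := by
    have hmj : m + 5 ≤ j := by
      refine le_trans ?_ hj
      clear hj ha
      induction m, hm using Nat.le_induction with
      | base => norm_num
      | succ m hm ih => rw [pow_succ]; lia
    obtain ⟨i, rfl⟩ : ∃ i, j = i + 1 := ⟨j - 1, by lia⟩
    have h2 : (2 : ℤ) ^ (m + 5) ∣ 2 ^ (i + 1) := pow_dvd_pow _ hmj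
    have h4 : (2 : ℤ) ^ (m + 5) ∣ 4 ^ (i + 1) :=
      h2.trans (pow_dvd_pow_of_dvd (by norm_num) _)
    have h6 : (2 : ℤ) ^ (m + 5) ∣ 6 ^ (i + 1) :=
      h2.trans (pow_dvd_pow_of_dvd (by norm_num) _)
    refine Int.modEq_iff_dvd.2 ?_
    rw [(factorial_mul_stirling2 i).2.2.2.2.2.2.2]
    have h := dvd_add (dvd_add (h6.mul_left 7) (h4.mul_left 35)) (h2.mul_left 21)
    refine h.trans (dvd_of_eq ?_)
    ring
  have e7 := pow_two_pow_modEq (x := 7) (c := 6) (by decide) hm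
  have e5 := pow_two_pow_modEq (x := 5) (c := 7) (by decide) hm
  have e3 := pow_two_pow_modEq (x := 3) (c := 5) (by decide) hm
  have hdiff := (formula (ha.trans (Nat.le_add_right a (2 ^ m)))).sub (formula ha)
  rw [← mul_sub] at hdiff
  refine hdiff.trans ?_
  have h := ((e7.mul_left (7 ^ a)).add ((e5.mul_left (21 * 5 ^ a)).add
    (e3.mul_left (35 * 3 ^ a)))).sub_right (7 ^ a + 21 * 5 ^ a + 35 * 3 ^ a)
  convert h using 1 <;> ring

theorem coefficient_modEq_of_even {a : ℕ} (ha : Even a) :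
    6 * 7 ^ a + 147 * 5 ^ a + 175 * 3 ^ a ≡ 0 [ZMOD 8] := by
  obtain ⟨r, rfl⟩ := ha
  have h (x : ℤ) (hx : x ^ 2 ≡ 1 [ZMOD 8]) : x ^ (r + r) ≡ 1 [ZMOD 8] := by
    simpa [← two_mul, pow_mul] using hx.pow r
  exact ((((h 7 (by decide)).mul_left 6).add ((h 5 (by decide)).mul_left 147)).add
    ((h 3 (by decide)).mul_left 175)).trans (by decide)

theorem coefficient_modEq_of_odd {a : ℕ} (ha : Odd a) :
    6 * 7 ^ a + 147 * 5 ^ a + 175 * 3 ^ a ≡ 6 [ZMOD 8] := by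
  obtain ⟨r, rfl⟩ := ha
  have h (x : ℤ) (hx : x ^ 2 ≡ 1 [ZMOD 8]) : x ^ (2 * r + 1) ≡ x [ZMOD 8] := by
    simpa [pow_succ, pow_mul] using (hx.pow r).mul_right x
  exact ((((h 7 (by decide)).mul_left 6).add ((h 5 (by decide)).mul_left 147)).add
    ((h 3 (by decide)).mul_left 175)).trans (by decide)

theorem stirling2_seven_modEq_iff {m a : ℕ} (hm : 3 ≤ m) (ha : 2 ^ m ≤ a) :
    stirling2 a 7 ≡ stirling2 (a + 2 ^ m) 7 [MOD 2 ^ (m + 1)] ↔ Even a := by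
  have key := stirling2_seven_add_two_pow hm ha
  rw [← Int.natCast_modEq_iff, Int.modEq_iff_dvd]
  push_cast
  set D : ℤ := (stirling2 (a + 2 ^ m) 7 : ℤ) - stirling2 a 7
  have hcop : IsCoprime ((2 : ℤ) ^ (m + 1)) 315 :=
    IsCoprime.pow_left ⟨-157, 1, by norm_num⟩
  have h16 : (2 : ℤ) ^ (m + 1) ∣ D ↔ (2 : ℤ) ^ (m + 5) ∣ 5040 * D := by
    rw [show (2 : ℤ) ^ (m + 5) = 16 * 2 ^ (m + 1) by ring,
      show 5040 * D = 16 * (315 * D) by ring, mul_dvd_mul_iff_left (by norm_num)]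
    exact ⟨fun h => h.mul_left _, hcop.dvd_of_dvd_mul_left⟩
  rw [h16, key.dvd_iff, show (2 : ℤ) ^ (m + 5) = 2 ^ (m + 2) * 8 by ring,
    mul_dvd_mul_iff_left (by positivity)]
  constructor
  · intro h
    by_contra hodd
    rw [(coefficient_modEq_of_odd (Nat.not_even_iff_odd.1 hodd)).dvd_iff] at h
    norm_num at h
  · intro h
    exact Int.modEq_zero_iff_dvd.1 (coefficient_modEq_of_even h)

theorem stirling2_seven_modEq_of_even {m a : ℕ} (hm : 3 ≤ m) (ha : 2 ^ m ≤ a) (he : Even a)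
    (t : ℕ) : stirling2 a 7 ≡ stirling2 (a + 2 ^ m * t) 7 [MOD 2 ^ (m + 1)] := by
  induction t with
  | zero => rfl
  | succ t ih =>
    have h2 : Even (2 ^ m) := (Nat.even_pow.2 ⟨even_two, by lia⟩)
    rw [mul_add_one, ← add_assoc]
    exact ih.trans ((stirling2_seven_modEq_iff hm (by lia)).2 (he.add (h2.mul_right t)))

theorem k7_nonconst_m1 (m n : ℕ) (hm : 3 ≤ m) (hn : 7 ≤ n) :
    ¬ ConstMod (2 ^ (m + 1)) (Scls 7 n m) ↔ Odd n := by
  have h2 : Even (2 ^ m) := (Nat.even_pow.2 ⟨even_two, by lia⟩)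
  rw [← Nat.not_even_iff_odd, not_iff_not]
  constructor
  · intro h
    have hmem : stirling2 (n + 2 ^ m) 7 ∈ Scls 7 n m :=
      ⟨n + 2 ^ m, ⟨by simp, by simp [Nat.ModEq]⟩, rfl⟩
    have hmem' : stirling2 (n + 2 ^ m + 2 ^ m) 7 ∈ Scls 7 n m :=
      ⟨n + 2 ^ m + 2 ^ m, ⟨by simp; lia, by simp [Nat.ModEq]⟩, rfl⟩
    have := (stirling2_seven_modEq_iff hm (by lia)).1 (h _ hmem _ hmem')
    exact (Nat.even_add.1 this).2 h2
  · rintro he _ ⟨a, ⟨ha, han⟩, rfl⟩ _ ⟨b, ⟨hb, hbn⟩, rfl⟩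
    have even_of {j : ℕ} (hj : j ≡ n [MOD 2 ^ m]) : Even j := by
      rw [even_iff_two_dvd] at he h2 ⊢
      exact (hj.dvd_iff h2).2 he
    have ordered {a b : ℕ} (ha : 2 ^ m ≤ a) (hab : a ≤ b) (hea : Even a)
        (h : a ≡ b [MOD 2 ^ m]) : stirling2 a 7 ≡ stirling2 b 7 [MOD 2 ^ (m + 1)] := by
      obtain ⟨t, ht⟩ := (Nat.modEq_iff_dvd' hab).1 h
      rw [show b = a + 2 ^ m * t by lia]
      exact stirling2_seven_modEq_of_even hm ha hea t
    have hab := han.trans hbn.symm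
    rcases le_total a b with hle | hle
    · exact ordered (le_of_max_le_right ha) hle (even_of han) hab
    · exact (ordered (le_of_max_le_right hb) hle (even_of hbn) hab.symm).symm
end
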